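/- Let $A$ be a finite set and $M_1, M_2$ be $\{0,1\}$-matrices indexed by $A$ satisfying $M_1 M_2 = M_2 M_1$ with $M_1 M_2$ again a $\{0,1\}$-matrix. For $m = (m_1, m_2) \in \mathbb{Z}_{\geq 0}^2$, define $W_m$ as the set of functions $w : [0,m_1] \times [0,m_2] \to A$ such that $M_1(w(l + e_1), w(l)) = 1$ and $M_2(w(l + e_2), w(l)) = 1$ whenever both arguments are in the domain. Then for $u \in W_m$ and $v \in W_n$ with $u(m) = v(0)$, there exists at most one $w \in W_{m+n}$ such that $w$ restricted to $[0,m]$ equals $u$ and $w$ restricted to $[m, m+n]$ equals the translate of $v$. -/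

import Mathlib

/-- A two-dimensional word of shape `m` over the alphabet `A`: the values on the
box `[0, m₁] × [0, m₂]` have horizontal transitions allowed by `M1` and vertical
transitions allowed by `M2`. -/
def IsWord {A : Type*} (M1 M2 : A → A → ℤ) (m : ℕ × ℕ) (w : ℕ × ℕ → A) : Prop :=
  (∀ i j, i < m.1 → j ≤ m.2 → M1 (w (i + 1, j)) (w (i, j)) = 1) ∧
  (∀ i j, i ≤ m.1 → j < m.2 → M2 (w (i, j + 1)) (w (i, j)) = 1)

/-- If `P * Q` is a `{0,1}`-matrix, the middle vertex of a two-step path is determined by its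
endpoints. -/
theorem middle_unique {A : Type*} [Fintype A] [DecidableEq A] {P Q : Matrix A A ℤ}
    (hP : ∀ a b, P a b = 0 ∨ P a b = 1) (hQ : ∀ a b, Q a b = 0 ∨ Q a b = 1)
    (hPQ : ∀ a b, (P * Q) a b = 0 ∨ (P * Q) a b = 1) {a c c' d : A}
    (h₁ : P d c = 1) (h₂ : Q c a = 1) (h₃ : P d c' = 1) (h₄ : Q c' a = 1) : c = c' := by
  by_contra hne
  have hle : ∑ x ∈ {c, c'}, P d x * Q x a ≤ (P * Q) d a := by
    rw [Matrix.mul_apply]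
    refine Finset.sum_le_sum_of_subset_of_nonneg (Finset.subset_univ _) fun x _ _ => ?_
    rcases hP d x with h | h <;> rcases hQ x a with h' | h' <;> simp [h, h']
  rw [Finset.sum_pair hne, h₁, h₂, h₃, h₄] at hle
  rcases hPQ d a with h | h <;> omega

/-- Two arrays with allowed transitions on `[0, p] × [0, q]` that agree on the bottom edge and on
the right edge agree everywhere. -/
theorem eq_of_eq_bottom_of_eq_right {A : Type*} [Fintype A] [DecidableEq A] {P Q : Matrix A A ℤ}
    (hP : ∀ a b, P a b = 0 ∨ P a b = 1) (hQ : ∀ a b, Q a b = 0 ∨ Q a b = 1)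
    (hPQ : ∀ a b, (P * Q) a b = 0 ∨ (P * Q) a b = 1) {p q : ℕ} {f g : ℕ → ℕ → A}
    (hfP : ∀ i j, i < p → j ≤ q → P (f (i + 1) j) (f i j) = 1)
    (hfQ : ∀ i j, i ≤ p → j < q → Q (f i (j + 1)) (f i j) = 1)
    (hgP : ∀ i j, i < p → j ≤ q → P (g (i + 1) j) (g i j) = 1)
    (hgQ : ∀ i j, i ≤ p → j < q → Q (g i (j + 1)) (g i j) = 1)
    (hbottom : ∀ i ≤ p, f i 0 = g i 0) (hright : ∀ j ≤ q, f p j = g p j)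
    {i j : ℕ} (hi : i ≤ p) (hj : j ≤ q) : f i j = g i j := by
  induction hi using Nat.decreasingInduction generalizing j with
  | self => exact hright j hj
  | of_succ i hi ih =>
    induction j with
    | zero => exact hbottom i hi.le
    | succ j ihj =>
      have hP' := hgP i (j + 1) hi hj
      have hQ' := hgQ i j hi.le hj
      rw [← ih hj] at hP'
      rw [← ihj (by omega)] at hQ'
      exact middle_unique hP hQ hPQ (hfP i (j + 1) hi hj) (hfQ i j hi.le hj) hP' hQ'

/-- Uniqueness part of condition (H1): a word of shape `m + n` restricting to `u`
on `[0,m]` and to the translate of `v` on `[m, m+n]` is unique (on the box). -/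
theorem stmt3 {A : Type*} [Fintype A] [DecidableEq A]
    (M1 M2 : Matrix A A ℤ)
    (h1 : ∀ a b, M1 a b = 0 ∨ M1 a b = 1)
    (h2 : ∀ a b, M2 a b = 0 ∨ M2 a b = 1)
    (hcomm : M1 * M2 = M2 * M1)
    (hprod : ∀ a b, (M1 * M2) a b = 0 ∨ (M1 * M2) a b = 1)
    (m n : ℕ × ℕ) (u v : ℕ × ℕ → A)
    (hu : IsWord (fun x y => M1 x y) (fun x y => M2 x y) m u)
    (hv : IsWord (fun x y => M1 x y) (fun x y => M2 x y) n v)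
    (hmatch : u (m.1, m.2) = v (0, 0))
    (w1 w2 : ℕ × ℕ → A)
    (hw1 : IsWord (fun x y => M1 x y) (fun x y => M2 x y) (m.1 + n.1, m.2 + n.2) w1)
    (hw2 : IsWord (fun x y => M1 x y) (fun x y => M2 x y) (m.1 + n.1, m.2 + n.2) w2)
    (hw1u : ∀ i j, i ≤ m.1 → j ≤ m.2 → w1 (i, j) = u (i, j))
    (hw2u : ∀ i j, i ≤ m.1 → j ≤ m.2 → w2 (i, j) = u (i, j))
    (hw1v : ∀ i j, i ≤ n.1 → j ≤ n.2 → w1 (m.1 + i, m.2 + j) = v (i, j))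
    (hw2v : ∀ i j, i ≤ n.1 → j ≤ n.2 → w2 (m.1 + i, m.2 + j) = v (i, j)) :
    ∀ i j, i ≤ m.1 + n.1 → j ≤ m.2 + n.2 → w1 (i, j) = w2 (i, j) := by
  intro i j hi hj
  rcases le_total i m.1 with him | him <;> rcases le_total j m.2 with hjm | hjm
  · rw [hw1u i j him hjm, hw2u i j him hjm]
  · obtain ⟨k, rfl⟩ := Nat.exists_eq_add_of_le hjm
    refine eq_of_eq_bottom_of_eq_right (p := m.1) (q := n.2) h1 h2 hprod
      (f := fun i j => w1 (i, m.2 + j)) (g := fun i j => w2 (i, m.2 + j))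
      (fun a b ha hb => hw1.1 a (m.2 + b) (by dsimp only; omega) (by dsimp only; omega))
      (fun a b ha hb => hw1.2 a (m.2 + b) (by dsimp only; omega) (by dsimp only; omega))
      (fun a b ha hb => hw2.1 a (m.2 + b) (by dsimp only; omega) (by dsimp only; omega))
      (fun a b ha hb => hw2.2 a (m.2 + b) (by dsimp only; omega) (by dsimp only; omega))
      (fun a ha => (hw1u a m.2 ha le_rfl).trans (hw2u a m.2 ha le_rfl).symm)
      (fun b hb => (hw1v 0 b (Nat.zero_le _) hb).trans (hw2v 0 b (Nat.zero_le _) hb).symm)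
      him (by omega)
  · obtain ⟨k, rfl⟩ := Nat.exists_eq_add_of_le him
    refine eq_of_eq_bottom_of_eq_right (p := m.2) (q := n.1) h2 h1 (hcomm ▸ hprod)
      (f := fun i j => w1 (m.1 + j, i)) (g := fun i j => w2 (m.1 + j, i))
      (fun a b ha hb => hw1.2 (m.1 + b) a (by dsimp only; omega) (by dsimp only; omega))
      (fun a b ha hb => hw1.1 (m.1 + b) a (by dsimp only; omega) (by dsimp only; omega))
      (fun a b ha hb => hw2.2 (m.1 + b) a (by dsimp only; omega) (by dsimp only; omega))
      (fun a b ha hb => hw2.1 (m.1 + b) a (by dsimp only; omega) (by dsimp only; omega))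
      (fun a ha => (hw1u m.1 a le_rfl ha).trans (hw2u m.1 a le_rfl ha).symm)
      (fun b hb => (hw1v b 0 hb (Nat.zero_le _)).trans (hw2v b 0 hb (Nat.zero_le _)).symm)
      hjm (by omega)
  · obtain ⟨k, rfl⟩ := Nat.exists_eq_add_of_le him
    obtain ⟨l, rfl⟩ := Nat.exists_eq_add_of_le hjm
    rw [hw1v k l (by omega) (by omega), hw2v k l (by omega) (by omega)]
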